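/- arXiv:1504.01702 — 2 statements merged into one kernel-verified Lean document; each statement's English description precedes it below -/
import Mathlib

section
/- Positive definiteness of the kernel K_beta: Fix beta ∈ (0,2) and let X be an ℝ^d-valued random variable with distribution F satisfying E|X|^beta < ∞. Then the kernel K_beta(x,y) = E|x − X|^beta + E|y − X|^beta − |x − y|^beta is a symmetric positive definite function on ℝ^d × ℝ^d. -/
open MeasureTheory

/-- Positive definiteness of a kernel in the finite-sum sense. -/
def IsPosDefKernel {𝒳 : Type*} (K : 𝒳 → 𝒳 → ℝ) : Prop :=
  ∀ (n : ℕ) (c : Fin n → ℝ) (x : Fin n → 𝒳),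
    0 ≤ ∑ i, ∑ j, c i * c j * K (x i) (x j)

open MeasureTheory ProbabilityTheory in
lemma gauss_eq {d : ℕ} (t : EuclideanSpace ℝ (Fin d)) :
    Real.exp (-‖t‖ ^ 2 / 2) = ∫ u, Real.cos (inner ℝ u t) ∂(stdGaussian (EuclideanSpace ℝ (Fin d))) := by
  have h := charFun_stdGaussian t
  rw [charFun_apply] at h
  have hi : Integrable (fun u : EuclideanSpace ℝ (Fin d) => Complex.exp ((inner ℝ u t : ℝ) * Complex.I))
      (stdGaussian (EuclideanSpace ℝ (Fin d))) := by
    refine Integrable.of_bound (C := 1) ?_ ?_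
    · exact Continuous.aestronglyMeasurable (by fun_prop)
    · refine Filter.Eventually.of_forall fun u => ?_
      rw [Complex.norm_exp_ofReal_mul_I]
  have h2 := congrArg Complex.re h
  have h3 := integral_re hi
  simp only [RCLike.re_eq_complex_re] at h3
  rw [← h3] at h2
  simp only [Complex.exp_ofReal_mul_I_re] at h2
  rw [h2]
  rw [show (-(‖t‖:ℂ) ^ 2 / 2) = ((-‖t‖ ^ 2 / 2 : ℝ) : ℂ) by push_cast; rfl, Complex.exp_ofReal_re]

open MeasureTheory ProbabilityTheory in
lemma gauss_pd {d n : ℕ} (c : Fin n → ℝ) (x : Fin n → EuclideanSpace ℝ (Fin d)) :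
    0 ≤ ∑ i, ∑ j, c i * c j * Real.exp (-‖x i - x j‖ ^ 2 / 2) := by
  have hi : ∀ t : EuclideanSpace ℝ (Fin d), Integrable (fun u => Real.cos (inner ℝ u t))
      (stdGaussian (EuclideanSpace ℝ (Fin d))) := by
    intro t
    refine Integrable.of_bound (C := 1) ?_ ?_
    · exact Continuous.aestronglyMeasurable (by fun_prop)
    · exact Filter.Eventually.of_forall fun u => Real.abs_cos_le_one _
  simp_rw [gauss_eq, ← integral_const_mul]
  simp_rw [← integral_finsetSum Finset.univ (fun j _ => (hi _).const_mul _)]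
  rw [← integral_finsetSum Finset.univ
    (fun i _ => integrable_finsetSum _ (fun j _ => (hi _).const_mul _))]
  refine integral_nonneg fun u => ?_
  have : ∑ i, ∑ j, c i * c j * Real.cos (inner ℝ u (x i - x j)) =
      (∑ i, c i * Real.cos (inner ℝ u (x i))) ^ 2 + (∑ i, c i * Real.sin (inner ℝ u (x i))) ^ 2 := by
    simp_rw [sq, Finset.sum_mul_sum, ← Finset.sum_add_distrib]
    refine Finset.sum_congr rfl fun i _ => Finset.sum_congr rfl fun j _ => ?_
    rw [inner_sub_right, Real.cos_sub]; ring
  simp only [Pi.zero_apply]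
  rw [this]; positivity

lemma gauss_pd' {d n : ℕ} (s : ℝ) (hs : 0 ≤ s) (c : Fin n → ℝ) (x : Fin n → EuclideanSpace ℝ (Fin d)) :
    0 ≤ ∑ i, ∑ j, c i * c j * Real.exp (-(s * ‖x i - x j‖ ^ 2)) := by
  have h := gauss_pd c (fun i => Real.sqrt (2 * s) • x i)
  convert h using 6
  rw [← smul_sub, norm_smul, mul_pow, Real.norm_eq_abs, sq_abs, Real.sq_sqrt (by positivity)]
  ring

lemma gauss_cond {d n : ℕ} (s : ℝ) (hs : 0 ≤ s) (c : Fin n → ℝ)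
    (x : Fin n → EuclideanSpace ℝ (Fin d)) (z : EuclideanSpace ℝ (Fin d)) :
    0 ≤ ∑ i, ∑ j, c i * c j * ((1 - Real.exp (-(s * ‖x i - z‖ ^ 2)))
      + (1 - Real.exp (-(s * ‖x j - z‖ ^ 2))) - (1 - Real.exp (-(s * ‖x i - x j‖ ^ 2)))) := by
  have h := gauss_pd' s hs (Fin.cons (-∑ i, c i) c : Fin (n+1) → ℝ)
    (Fin.cons z x : Fin (n+1) → EuclideanSpace ℝ (Fin d))
  simp only [Fin.sum_univ_succ, Fin.cons_zero, Fin.cons_succ, sub_self, norm_zero] at h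
  convert h using 1
  simp only [norm_sub_rev z]
  simp only [mul_sub, mul_add, Finset.sum_add_distrib, Finset.sum_sub_distrib]
  have e1 : ∑ i, ∑ j, c i * c j * 1 = (∑ i, c i) * (∑ j, c j) := by
    rw [Finset.sum_mul_sum]; simp
  have e2 : ∑ i, ∑ j, c i * c j * Real.exp (-(s * ‖x i - z‖ ^ 2))
      = (∑ i, c i * Real.exp (-(s * ‖x i - z‖ ^ 2))) * (∑ j, c j) := by
    rw [Finset.sum_mul_sum]
    refine Finset.sum_congr rfl fun i _ => Finset.sum_congr rfl fun j _ => by ring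
  have e3 : ∑ i, ∑ j, c i * c j * Real.exp (-(s * ‖x j - z‖ ^ 2))
      = (∑ j, c j) * (∑ i, c i * Real.exp (-(s * ‖x i - z‖ ^ 2))) := by
    rw [Finset.sum_mul_sum]
    refine Finset.sum_congr rfl fun i _ => Finset.sum_congr rfl fun j _ => by ring
  have e4 : ∑ j, (-∑ i, c i) * c j * Real.exp (-(s * ‖x j - z‖ ^ 2))
      = (-∑ j, c j) * (∑ i, c i * Real.exp (-(s * ‖x i - z‖ ^ 2))) := by
    rw [Finset.mul_sum]
    refine Finset.sum_congr rfl fun i _ => by ring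
  have e5 : ∑ j, c j * (-∑ i, c i) * Real.exp (-(s * ‖x j - z‖ ^ 2))
      = (-∑ j, c j) * (∑ i, c i * Real.exp (-(s * ‖x i - z‖ ^ 2))) := by
    rw [Finset.mul_sum]
    refine Finset.sum_congr rfl fun i _ => by ring
  rw [e1, e2, e3, e4, e5]
  simp
  ring

open MeasureTheory Set in
lemma g_int (a r : ℝ) (ha : 0 < a) (ha1 : a < 1) (hr : 0 ≤ r) :
    IntegrableOn (fun s : ℝ => (1 - Real.exp (-(s * r))) * s ^ (-a - 1)) (Ioi 0) := by
  have hm : Measurable (fun s : ℝ => (1 - Real.exp (-(s * r))) * s ^ (-a - 1)) := by fun_prop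
  rw [← Ioc_union_Ioi_eq_Ioi (zero_le_one' ℝ)]
  refine IntegrableOn.union ?_ ?_
  · have h : IntegrableOn (fun s : ℝ => r * s ^ (-a)) (Ioc 0 1) := by
      have := (intervalIntegral.intervalIntegrable_rpow' (a := 0) (b := 1) (r := -a) (by linarith))
      rw [intervalIntegrable_iff_integrableOn_Ioc_of_le zero_le_one] at this
      exact this.const_mul r
    refine h.mono' hm.aestronglyMeasurable ?_
    refine (ae_restrict_iff' measurableSet_Ioc).2 (Filter.Eventually.of_forall fun s hs => ?_)
    have h0 : 0 ≤ s * r := mul_nonneg hs.1.le hr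
    have h1 : Real.exp (-(s * r)) ≤ 1 := Real.exp_le_one_iff.2 (by linarith)
    have h2 := Real.add_one_le_exp (-(s * r))
    have h3 : s ^ (-a) = s * s ^ (-a - 1) := by
      rw [Real.rpow_sub_one hs.1.ne']; field_simp [hs.1.ne']
    have h4 : 0 ≤ s ^ (-a - 1) := Real.rpow_nonneg hs.1.le _
    rw [Real.norm_eq_abs, abs_of_nonneg (mul_nonneg (by linarith) h4), h3, ← mul_assoc]
    exact mul_le_mul_of_nonneg_right (by linarith) h4
  · have h := integrableOn_Ioi_rpow_of_lt (a := -a - 1) (by linarith) one_pos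
    refine h.mono' hm.aestronglyMeasurable ?_
    refine (ae_restrict_iff' measurableSet_Ioi).2 (Filter.Eventually.of_forall fun s hs => ?_)
    have hs0 : 0 < s := lt_trans one_pos hs
    have h0 : 0 ≤ s * r := mul_nonneg hs0.le hr
    have h1 : Real.exp (-(s * r)) ≤ 1 := Real.exp_le_one_iff.2 (by linarith)
    have h4 : 0 ≤ s ^ (-a - 1) := Real.rpow_nonneg hs0.le _
    rw [Real.norm_eq_abs, abs_of_nonneg (mul_nonneg (by linarith) h4)]
    have := Real.exp_pos (-(s * r))
    nlinarith

open MeasureTheory Set in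
lemma g_scale (a r : ℝ) (ha : 0 < a) (hr : 0 ≤ r) :
    ∫ s in Ioi (0:ℝ), (1 - Real.exp (-(s * r))) * s ^ (-a - 1)
      = r ^ a * ∫ s in Ioi (0:ℝ), (1 - Real.exp (-(s * 1))) * s ^ (-a - 1) := by
  rcases hr.eq_or_lt with rfl | hr
  · simp [Real.zero_rpow ha.ne']
  have h := integral_comp_mul_left_Ioi (fun s : ℝ => (1 - Real.exp (-(s * 1))) * s ^ (-a - 1)) 0 hr
  rw [mul_zero, smul_eq_mul] at h
  have h2 : ∫ s in Ioi (0:ℝ), (1 - Real.exp (-(r * s * 1))) * (r * s) ^ (-a - 1)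
      = r ^ (-a - 1) * ∫ s in Ioi (0:ℝ), (1 - Real.exp (-(s * r))) * s ^ (-a - 1) := by
    rw [← integral_const_mul]
    refine setIntegral_congr_fun measurableSet_Ioi fun s hs => ?_
    rw [Real.mul_rpow hr.le (le_of_lt hs), mul_one, mul_comm r s]; ring
  rw [h2] at h
  have h3 : r ^ a * r ^ (-a - 1) = r⁻¹ := by
    rw [← Real.rpow_add hr, ← Real.rpow_neg_one]; congr 1; ring
  have h4 : r⁻¹ ≠ 0 := inv_ne_zero hr.ne'
  apply mul_left_cancel₀ h4
  rw [mul_left_comm, ← h, ← mul_assoc, h3]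

open MeasureTheory Set in
lemma g_pos (a : ℝ) (ha : 0 < a) (ha1 : a < 1) :
    0 < ∫ s in Ioi (0:ℝ), (1 - Real.exp (-(s * 1))) * s ^ (-a - 1) := by
  have hp : ∀ s ∈ Ioi (0:ℝ), 0 < (1 - Real.exp (-(s * 1))) * s ^ (-a - 1) := by
    intro s hs
    have hs0 : 0 < s := hs
    have : Real.exp (-(s * 1)) < 1 := by
      rw [Real.exp_lt_one_iff]; linarith
    exact mul_pos (by linarith) (Real.rpow_pos_of_pos hs _)
  rw [setIntegral_pos_iff_support_of_nonneg_ae ?_ (g_int a 1 ha ha1 zero_le_one)]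
  · rw [inter_eq_right.2 (fun s hs => Function.mem_support.2 (hp s hs).ne')]
    simp
  · exact (ae_restrict_iff' measurableSet_Ioi).2 (Filter.Eventually.of_forall fun s hs => (hp s hs).le)

open MeasureTheory Set in
lemma pow_cond {d n : ℕ} (β : ℝ) (hβ : β ∈ Set.Ioo (0 : ℝ) 2) (c : Fin n → ℝ)
    (x : Fin n → EuclideanSpace ℝ (Fin d)) (z : EuclideanSpace ℝ (Fin d)) :
    0 ≤ ∑ i, ∑ j, c i * c j * (‖x i - z‖ ^ β + ‖x j - z‖ ^ β - ‖x i - x j‖ ^ β) := by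
  have ha : 0 < β / 2 := by linarith [hβ.1]
  have ha1 : β / 2 < 1 := by linarith [hβ.2]
  have hC := g_pos (β / 2) ha ha1
  set C := ∫ s in Ioi (0:ℝ), (1 - Real.exp (-(s * 1))) * s ^ (-(β / 2) - 1) with hCdef
  have hrep : ∀ t : EuclideanSpace ℝ (Fin d), ‖t‖ ^ β * C =
      ∫ s in Ioi (0:ℝ), (1 - Real.exp (-(s * ‖t‖ ^ 2))) * s ^ (-(β / 2) - 1) := by
    intro t
    rw [g_scale (β / 2) (‖t‖ ^ 2) ha (by positivity), ← Real.rpow_natCast,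
      ← Real.rpow_mul (norm_nonneg _)]
    congr 2; push_cast; ring
  have hI : ∀ t : EuclideanSpace ℝ (Fin d), IntegrableOn
      (fun s : ℝ => (1 - Real.exp (-(s * ‖t‖ ^ 2))) * s ^ (-(β / 2) - 1)) (Ioi 0) :=
    fun t => g_int _ _ ha ha1 (by positivity)
  refine nonneg_of_mul_nonneg_left ?_ hC
  have hij : ∀ i j, c i * c j * (‖x i - z‖ ^ β + ‖x j - z‖ ^ β - ‖x i - x j‖ ^ β) * C =
      ∫ s in Ioi (0:ℝ), c i * c j * ((1 - Real.exp (-(s * ‖x i - z‖ ^ 2))) * s ^ (-(β / 2) - 1)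
      + (1 - Real.exp (-(s * ‖x j - z‖ ^ 2))) * s ^ (-(β / 2) - 1)
      - (1 - Real.exp (-(s * ‖x i - x j‖ ^ 2))) * s ^ (-(β / 2) - 1)) := by
    intro i j
    rw [integral_const_mul, integral_sub (by exact (hI _).add (hI _)) (hI _), integral_add (hI _) (hI _),
      ← hrep, ← hrep, ← hrep]
    ring
  have hint : ∀ i j, IntegrableOn (fun s : ℝ =>
      c i * c j * ((1 - Real.exp (-(s * ‖x i - z‖ ^ 2))) * s ^ (-(β / 2) - 1)
      + (1 - Real.exp (-(s * ‖x j - z‖ ^ 2))) * s ^ (-(β / 2) - 1)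
      - (1 - Real.exp (-(s * ‖x i - x j‖ ^ 2))) * s ^ (-(β / 2) - 1))) (Ioi 0) :=
    fun i j => (((hI _).add (hI _)).sub (hI _)).const_mul _
  simp_rw [Finset.sum_mul, hij]
  simp_rw [← integral_finsetSum Finset.univ (fun j _ => hint _ j)]
  rw [← integral_finsetSum Finset.univ
    (fun i _ => integrable_finsetSum _ (fun j _ => hint i j))]
  refine setIntegral_nonneg measurableSet_Ioi fun s hs => ?_
  have hs0 : (0:ℝ) < s := hs
  have h := mul_nonneg (gauss_cond s hs0.le c x z) (Real.rpow_nonneg hs0.le (-(β / 2) - 1))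
  rw [Finset.sum_mul] at h
  refine h.trans_eq (Finset.sum_congr rfl fun i _ => ?_)
  rw [Finset.sum_mul]
  refine Finset.sum_congr rfl fun j _ => ?_
  ring

/-- Positive definiteness of the kernel `K_β`: fix `β ∈ (0,2)` and let `X` be an
`ℝᵈ`-valued random variable with distribution `F = μ` satisfying `E|X|^β < ∞`.
Then `K_β(x,y) = E|x − X|^β + E|y − X|^β − |x − y|^β` is a symmetric positive
definite function on `ℝᵈ × ℝᵈ`. -/
theorem Kbeta_symm_posdef {d : ℕ} (β : ℝ) (hβ : β ∈ Set.Ioo (0 : ℝ) 2)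
    (μ : Measure (EuclideanSpace ℝ (Fin d))) [IsProbabilityMeasure μ]
    (hmom : Integrable (fun x => ‖x‖ ^ β) μ) :
    (∀ x y : EuclideanSpace ℝ (Fin d),
        (∫ u, ‖x - u‖ ^ β ∂μ) + (∫ u, ‖y - u‖ ^ β ∂μ) - ‖x - y‖ ^ β
          = (∫ u, ‖y - u‖ ^ β ∂μ) + (∫ u, ‖x - u‖ ^ β ∂μ) - ‖y - x‖ ^ β) ∧
    IsPosDefKernel (fun x y : EuclideanSpace ℝ (Fin d) =>
      (∫ u, ‖x - u‖ ^ β ∂μ) + (∫ u, ‖y - u‖ ^ β ∂μ) - ‖x - y‖ ^ β) := by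
  refine ⟨fun x y => by rw [norm_sub_rev x y]; ring, ?_⟩
  intro n c x
  have hb0 : 0 < β := hβ.1
  have hi : ∀ x : EuclideanSpace ℝ (Fin d), Integrable (fun u => ‖x - u‖ ^ β) μ := by
    intro x
    have hp0 : ENNReal.ofReal β ≠ 0 := by simpa using hb0
    have hid : MemLp (fun u : EuclideanSpace ℝ (Fin d) => u) (ENNReal.ofReal β) μ := by
      rw [← integrable_norm_rpow_iff (by fun_prop) hp0 ENNReal.ofReal_ne_top,
        ENNReal.toReal_ofReal hb0.le]
      exact hmom
    have h := ((memLp_const x).sub hid).integrable_norm_rpow hp0 ENNReal.ofReal_ne_top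
    rw [ENNReal.toReal_ofReal hb0.le] at h
    exact h
  have hij : ∀ i j, c i * c j * ((∫ u, ‖x i - u‖ ^ β ∂μ) + (∫ u, ‖x j - u‖ ^ β ∂μ)
      - ‖x i - x j‖ ^ β) =
      ∫ u, c i * c j * (‖x i - u‖ ^ β + ‖x j - u‖ ^ β - ‖x i - x j‖ ^ β) ∂μ := by
    intro i j
    rw [integral_const_mul, integral_sub (by exact (hi _).add (hi _)) (integrable_const _),
      integral_add (hi _) (hi _)]
    simp
  have hint : ∀ i j, Integrable (fun u =>
      c i * c j * (‖x i - u‖ ^ β + ‖x j - u‖ ^ β - ‖x i - x j‖ ^ β)) μ :=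
    fun i j => (((hi _).add (hi _)).sub (integrable_const _)).const_mul _
  simp_rw [hij]
  simp_rw [← integral_finsetSum Finset.univ (fun j _ => hint _ j)]
  rw [← integral_finsetSum Finset.univ
    (fun i _ => integrable_finsetSum _ (fun j _ => hint i j))]
  exact integral_nonneg fun u => pow_cond β hβ c x u
end

section
/- Integrated centering preserves positive definiteness: Let φ: ℝ^d × ℝ^d → ℝ be a symmetric conditionally negative definite function with φ(u,u) = 0 for all u, and let F be a probability distribution on ℝ^d such that ∫ |φ(x,u)| dF(u) < ∞ for every x ∈ ℝ^d. Then the kernel K(x,y) = ∫ ( φ(x,u) + φ(u,y) − φ(x,y) ) dF(u) is positive definite on ℝ^d × ℝ^d. -/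
open MeasureTheory

/-- Conditional negative definiteness of a kernel in the finite-sum sense. -/
def IsCondNegDefKernel {𝒳 : Type*} (K : 𝒳 → 𝒳 → ℝ) : Prop :=
  ∀ (n : ℕ) (c : Fin n → ℝ) (x : Fin n → 𝒳), (∑ i, c i) = 0 →
    ∑ i, ∑ j, c i * c j * K (x i) (x j) ≤ 0

/-- Integrated centering preserves positive definiteness: if `φ : ℝᵈ × ℝᵈ → ℝ`
is a symmetric conditionally negative definite function with `φ(u,u) = 0` for
all `u`, and `F = μ` is a probability distribution on `ℝᵈ` such that
`∫ |φ(x,u)| dF(u) < ∞` for every `x`, then the kernel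
`K(x,y) = ∫ (φ(x,u) + φ(u,y) − φ(x,y)) dF(u)` is positive definite. -/
theorem integrated_centering_posdef {d : ℕ}
    (φ : EuclideanSpace ℝ (Fin d) → EuclideanSpace ℝ (Fin d) → ℝ)
    (hsymm : ∀ x y, φ x y = φ y x)
    (hcnd : IsCondNegDefKernel φ)
    (hdiag : ∀ u, φ u u = 0)
    (μ : Measure (EuclideanSpace ℝ (Fin d))) [IsProbabilityMeasure μ]
    (hint : ∀ x, Integrable (fun u => φ x u) μ) :
    IsPosDefKernel (fun x y : EuclideanSpace ℝ (Fin d) =>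
      ∫ u, (φ x u + φ u y - φ x y) ∂μ) := by
  intro n c x
  have hpt : ∀ u, 0 ≤ ∑ i, ∑ j, c i * c j * (φ (x i) u + φ u (x j) - φ (x i) (x j)) := by
    intro u
    have h := hcnd (n + 1) (Fin.cons (-∑ i, c i) c) (Fin.cons u x) (by simp [Fin.sum_univ_succ])
    simp only [Fin.sum_univ_succ, Fin.cons_zero, Fin.cons_succ, hdiag, Finset.sum_add_distrib] at h
    have e1 : ∑ i, ∑ j, c i * c j * φ (x i) u = (∑ i, c i) * ∑ i, c i * φ (x i) u := by
      rw [Finset.sum_comm, Finset.sum_mul_sum]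
      refine Finset.sum_congr rfl fun i _ => Finset.sum_congr rfl fun j _ => by ring
    have e2 : ∑ i, ∑ j, c i * c j * φ u (x j) = (∑ i, c i) * ∑ i, c i * φ u (x i) := by
      rw [Finset.sum_mul_sum]
      refine Finset.sum_congr rfl fun i _ => Finset.sum_congr rfl fun j _ => by ring
    have e3 : ∑ i, c i * (-∑ k, c k) * φ (x i) u = -((∑ i, c i) * ∑ i, c i * φ (x i) u) := by
      generalize (∑ k, c k) = C
      rw [Finset.mul_sum, ← Finset.sum_neg_distrib]
      exact Finset.sum_congr rfl fun i _ => by ring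
    have e4 : ∑ i, (-∑ k, c k) * c i * φ u (x i) = -((∑ i, c i) * ∑ i, c i * φ u (x i)) := by
      generalize (∑ k, c k) = C
      rw [Finset.mul_sum, ← Finset.sum_neg_distrib]
      exact Finset.sum_congr rfl fun i _ => by ring
    rw [e3, e4] at h
    simp only [mul_sub, mul_add, Finset.sum_sub_distrib, Finset.sum_add_distrib]
    rw [e1, e2]
    linarith
  have hI : ∀ a b, Integrable (fun u => φ a u + φ u b - φ a b) μ := by
    intro a b
    have hb : Integrable (fun u => φ u b) μ := by
      simpa only [hsymm b] using hint b
    exact ((hint a).add hb).sub (integrable_const _)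
  have key : ∑ i, ∑ j, c i * c j * ∫ u, (φ (x i) u + φ u (x j) - φ (x i) (x j)) ∂μ
      = ∫ u, ∑ i, ∑ j, c i * c j * (φ (x i) u + φ u (x j) - φ (x i) (x j)) ∂μ := by
    rw [integral_finsetSum _ fun i _ => integrable_finsetSum _ fun j _ => (hI _ _).const_mul _]
    refine Finset.sum_congr rfl fun i _ => ?_
    rw [integral_finsetSum _ fun j _ => (hI _ _).const_mul _]
    refine Finset.sum_congr rfl fun j _ => ?_
    rw [integral_const_mul]
  show 0 ≤ ∑ i, ∑ j, c i * c j * ∫ u, (φ (x i) u + φ u (x j) - φ (x i) (x j)) ∂μ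
  rw [key]
  exact integral_nonneg hpt
end
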